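/- arXiv:math/0612278 — 7 statements merged into one kernel-verified Lean document; each statement's English description precedes it below -/
import Mathlib

section
/- Let {ν_{nk} : n ≥ 1, 1 ≤ k ≤ k_n} be an infinitesimal triangular array of Borel probability measures on ℝ₊ = (0, +∞), fix τ > 0, and define b_{nk} = exp(∫_{e^{−τ}}^{e^{τ}} log t dν_{nk}(t)), the centered measure ν°_{nk} as the pushforward of ν_{nk} under t ↦ t/b_{nk}, and for w ∈ ℂ ∖ [0, +∞) the function g_{nk}(w) = ∫₀^∞ (t² − 1)/(t² + 1) dν̂_{nk}(t) + ∫₀^∞ [(1 + tw)/(w − t)] · (t − 1)²/(t² + 1) dν̂_{nk}(t), where ν̂_{nk} is the pushforward of ν°_{nk} under t ↦ 1/t. Then for every compact set K contained in {w ∈ ℂ : Re w < 0 and Im w > 0} there exists a constant M = M(τ, K) > 0 such that for all sufficiently large n: |Re g_{nk}(w)| ≤ M |Im g_{nk}(w)| for every w ∈ K and every 1 ≤ k ≤ k_n. -/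
open MeasureTheory Filter Topology

/-- Elementary bounds for the logarithm versus `(T²-1)/(T²+1)`. -/
lemma aux_log (T : ℝ) (hT : 0 < T) (B : ℝ) (h1 : T ≤ B) (h2 : T⁻¹ ≤ B) :
    |(T ^ 2 - 1) / (T ^ 2 + 1) - Real.log T| ≤ B * ((T - 1) ^ 2 / (T ^ 2 + 1)) := by
  have hψ : 0 ≤ (T - 1) ^ 2 / (T ^ 2 + 1) := by positivity
  have hu := Real.log_le_sub_one_of_pos hT
  have hl := Real.one_sub_inv_le_log_of_pos hT
  have e1 : T - 1 - (T ^ 2 - 1) / (T ^ 2 + 1) = T * ((T - 1) ^ 2 / (T ^ 2 + 1)) := by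
    field_simp
    ring
  have e2 : (T ^ 2 - 1) / (T ^ 2 + 1) - (1 - T⁻¹) = T⁻¹ * ((T - 1) ^ 2 / (T ^ 2 + 1)) := by
    field_simp
    ring
  have b1 := mul_le_mul_of_nonneg_right h1 hψ
  have b2 := mul_le_mul_of_nonneg_right h2 hψ
  rw [abs_le]
  constructor <;> linarith

lemma aux_phi (T : ℝ) : |(T ^ 2 - 1) / (T ^ 2 + 1)| ≤ 1 := by
  have h : 0 < T ^ 2 + 1 := by positivity
  rw [abs_le, le_div_iff₀ h, div_le_iff₀ h]
  constructor <;> nlinarith [sq_nonneg T]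

lemma aux_psi (T : ℝ) (hT : 0 ≤ T) : (T - 1) ^ 2 / (T ^ 2 + 1) ≤ 1 := by
  have h : 0 < T ^ 2 + 1 := by positivity
  rw [div_le_iff₀ h]
  nlinarith

lemma aux_far (q T : ℝ) (hq : 1 < q) (hT : 0 < T) (h : q ≤ T ∨ q * T ≤ 1) :
    (q - 1) ^ 2 / (q ^ 2 + 1) ≤ (T - 1) ^ 2 / (T ^ 2 + 1) := by
  rw [div_le_div_iff₀ (by positivity) (by positivity)]
  have key : 0 ≤ (T - q) * (q * T - 1) := by
    rcases h with h | h
    · exact mul_nonneg (by linarith) (by nlinarith)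
    · exact mul_nonneg_of_nonpos_of_nonpos (by nlinarith) (by linarith)
  nlinarith

/-- The truncated logarithm. -/
noncomputable def truncLog (τ : ℝ) : ℝ → ℝ :=
  (Set.Ioo (Real.exp (-τ)) (Real.exp τ)).indicator Real.log

lemma truncLog_meas (τ : ℝ) : Measurable (truncLog τ) :=
  Real.measurable_log.indicator measurableSet_Ioo

lemma mem_Ioo_iff (τ x : ℝ) (hx : 0 < x) :
    x ∈ Set.Ioo (Real.exp (-τ)) (Real.exp τ) ↔ |Real.log x| < τ := by
  rw [Set.mem_Ioo, ← Real.lt_log_iff_exp_lt hx, ← Real.log_lt_iff_lt_exp hx, abs_lt]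

lemma truncLog_abs (τ x : ℝ) (hτ : 0 < τ) : |truncLog τ x| ≤ τ := by
  unfold truncLog
  by_cases h : x ∈ Set.Ioo (Real.exp (-τ)) (Real.exp τ)
  · rw [Set.indicator_of_mem h]
    have hx : 0 < x := lt_trans (Real.exp_pos _) h.1
    exact ((mem_Ioo_iff τ x hx).1 h).le
  · rw [Set.indicator_of_notMem h]
    simpa using hτ.le

/-- The constant in the pointwise estimate. -/
noncomputable def cst (τ : ℝ) : ℝ :=
  Real.exp (2 * τ) +
    (1 + τ) / ((Real.exp (τ / 2) - 1) ^ 2 / (Real.exp (τ / 2) ^ 2 + 1))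

lemma cst_pos (τ : ℝ) (hτ : 0 < τ) : 0 < cst τ := by
  unfold cst
  positivity

lemma pointwise (τ a x : ℝ) (hτ : 0 < τ) (ha : |a| ≤ τ / 2) (hx : 0 < x) (T : ℝ)
    (hT : T = 1 / (x / Real.exp a)) :
    |(T ^ 2 - 1) / (T ^ 2 + 1) + truncLog τ x - a| ≤ cst τ * ((T - 1) ^ 2 / (T ^ 2 + 1)) := by
  have hTpos : 0 < T := by rw [hT]; positivity
  have hψ : 0 ≤ (T - 1) ^ 2 / (T ^ 2 + 1) := by positivity
  have hlog : Real.log T = a - Real.log x := by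
    rw [hT, one_div_div, Real.log_div (Real.exp_pos a).ne' hx.ne', Real.log_exp]
  have hq : 1 < Real.exp (τ / 2) := Real.one_lt_exp_iff.2 (by linarith)
  have hc0 : 0 < (Real.exp (τ / 2) - 1) ^ 2 / (Real.exp (τ / 2) ^ 2 + 1) := by
    have : 0 < Real.exp (τ / 2) - 1 := by linarith
    positivity
  obtain ⟨ha1, ha2⟩ := abs_le.1 ha
  unfold cst
  rw [add_mul]
  by_cases h : x ∈ Set.Ioo (Real.exp (-τ)) (Real.exp τ)
  · have hL := abs_lt.1 ((mem_Ioo_iff τ x hx).1 h)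
    have e : (T ^ 2 - 1) / (T ^ 2 + 1) + truncLog τ x - a
        = (T ^ 2 - 1) / (T ^ 2 + 1) - Real.log T := by
      unfold truncLog
      rw [Set.indicator_of_mem h, hlog]; ring
    rw [e]
    have h1 : T ≤ Real.exp (2 * τ) := by
      rw [← Real.log_le_iff_le_exp hTpos, hlog]; linarith
    have h2 : T⁻¹ ≤ Real.exp (2 * τ) := by
      rw [← Real.log_le_iff_le_exp (inv_pos.2 hTpos), Real.log_inv, hlog]; linarith
    have := aux_log T hTpos _ h1 h2
    have : 0 ≤ (1 + τ) / ((Real.exp (τ / 2) - 1) ^ 2 / (Real.exp (τ / 2) ^ 2 + 1))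
      * ((T - 1) ^ 2 / (T ^ 2 + 1)) := by positivity
    linarith
  · have hL : τ ≤ |Real.log x| := by
      rw [mem_Ioo_iff τ x hx] at h
      exact not_lt.1 h
    have hfar : Real.exp (τ / 2) ≤ T ∨ Real.exp (τ / 2) * T ≤ 1 := by
      rcases le_abs.1 hL with h' | h'
      · right
        rw [← Real.log_nonpos_iff (by positivity),
          Real.log_mul (Real.exp_pos _).ne' hTpos.ne', Real.log_exp, hlog]
        linarith
      · left
        rw [← Real.le_log_iff_exp_le hTpos, hlog]; linarith
    have hf := aux_far _ T hq hTpos hfar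
    have e : truncLog τ x = 0 := by
      unfold truncLog
      exact Set.indicator_of_notMem h _
    rw [e, add_zero]
    have hφ := aux_phi T
    have h3 : |(T ^ 2 - 1) / (T ^ 2 + 1) - a| ≤ 1 + τ := by
      rw [abs_le] at hφ ⊢
      constructor <;> linarith
    have h4 : 1 + τ ≤ (1 + τ) / ((Real.exp (τ / 2) - 1) ^ 2 / (Real.exp (τ / 2) ^ 2 + 1))
      * ((T - 1) ^ 2 / (T ^ 2 + 1)) := by
      rw [div_mul_eq_mul_div, le_div_iff₀ hc0]
      exact mul_le_mul_of_nonneg_left hf (by linarith)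
    have h5 : 0 ≤ Real.exp (2 * τ) * ((T - 1) ^ 2 / (T ^ 2 + 1)) := by positivity
    linarith

lemma psi_integrable (μ : Measure ℝ) [IsProbabilityMeasure μ] (hpos : ∀ᵐ t ∂μ, 0 < t) :
    Integrable (fun t : ℝ => (t - 1) ^ 2 / (t ^ 2 + 1)) μ := by
  refine Integrable.of_bound (C := 1) (Measurable.aestronglyMeasurable (by fun_prop)) ?_
  filter_upwards [hpos] with t ht
  rw [Real.norm_eq_abs, abs_of_nonneg (by positivity)]
  exact aux_psi t ht.le

lemma phi_integrable (μ : Measure ℝ) [IsProbabilityMeasure μ] :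
    Integrable (fun t : ℝ => (t ^ 2 - 1) / (t ^ 2 + 1)) μ := by
  refine Integrable.of_bound (C := 1) (Measurable.aestronglyMeasurable (by fun_prop)) ?_
  exact Eventually.of_forall fun t => aux_phi t

lemma first_bound (τ a : ℝ) (hτ : 0 < τ) (ν μ : Measure ℝ) [IsProbabilityMeasure ν]
    (hpos : ∀ᵐ t ∂ν, 0 < t) (ha : |a| ≤ τ / 2) (hae : a = ∫ x, truncLog τ x ∂ν)
    (hμ : μ = Measure.map (fun x => 1 / (x / Real.exp a)) ν) :
    |∫ t, (t ^ 2 - 1) / (t ^ 2 + 1) ∂μ| ≤ cst τ * ∫ t, (t - 1) ^ 2 / (t ^ 2 + 1) ∂μ := by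
  have hm : Measurable (fun x : ℝ => 1 / (x / Real.exp a)) := by fun_prop
  have hpr : IsProbabilityMeasure μ := by
    rw [hμ]; exact Measure.isProbabilityMeasure_map hm.aemeasurable
  have hμpos : ∀ᵐ t ∂μ, 0 < t := by
    rw [hμ, ae_map_iff hm.aemeasurable measurableSet_Ioi]
    filter_upwards [hpos] with x hx
    positivity
  have i1 := phi_integrable μ
  have i2 := psi_integrable μ hμpos
  rw [hμ] at i1 i2
  have j1 := i1.comp_measurable hm
  have j2 := i2.comp_measurable hm
  have j3 : Integrable (truncLog τ) ν :=
    Integrable.of_bound (C := τ) (truncLog_meas τ).aestronglyMeasurable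
      (Eventually.of_forall fun x => truncLog_abs τ x hτ)
  rw [hμ, integral_map hm.aemeasurable i1.1, integral_map hm.aemeasurable i2.1]
  have e : ∫ x, ((fun t : ℝ => (t ^ 2 - 1) / (t ^ 2 + 1)) ∘
        (fun x : ℝ => 1 / (x / Real.exp a))) x ∂ν
      = ∫ x, (((fun t : ℝ => (t ^ 2 - 1) / (t ^ 2 + 1)) ∘
        (fun x : ℝ => 1 / (x / Real.exp a))) x + truncLog τ x - a) ∂ν := by
    have e3 := integral_sub (j1.add j3) (integrable_const a)
    have e4 := integral_add j1 j3
    simp only [Pi.add_apply] at e3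
    rw [e3, e4, ← hae]
    simp
  simp only [Function.comp_def] at e
  simp only [Function.comp_def] at j2
  rw [e, ← integral_const_mul, ← Real.norm_eq_abs]
  refine norm_integral_le_of_norm_le (j2.const_mul _) ?_
  filter_upwards [hpos] with x hx
  exact pointwise τ a x hτ ha hx _ rfl

lemma center_bound (τ ε : ℝ) (hτ : 0 < τ) (hε : ∀ t : ℝ, |t - 1| < ε → |Real.log t| ≤ τ / 4)
    (ν : Measure ℝ) [IsProbabilityMeasure ν]
    (h : (ν {t : ℝ | ε ≤ |t - 1|}).toReal ≤ 1 / 4) :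
    |∫ x, truncLog τ x ∂ν| ≤ τ / 2 := by
  have hS : MeasurableSet {t : ℝ | ε ≤ |t - 1|} :=
    measurableSet_le measurable_const (by fun_prop)
  have i1 : Integrable ({t : ℝ | ε ≤ |t - 1|}.indicator (fun _ => τ)) ν :=
    (integrable_const τ).indicator hS
  have key : |∫ x, truncLog τ x ∂ν|
      ≤ ∫ x, (τ / 4 + {t : ℝ | ε ≤ |t - 1|}.indicator (fun _ => τ) x) ∂ν := by
    rw [← Real.norm_eq_abs]
    refine norm_integral_le_of_norm_le ((integrable_const (τ / 4)).add i1) ?_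
    refine Eventually.of_forall fun x => ?_
    rw [Real.norm_eq_abs]
    by_cases hx : ε ≤ |x - 1|
    · rw [Set.indicator_of_mem (by exact hx)]
      have := truncLog_abs τ x hτ
      linarith
    · rw [Set.indicator_of_notMem (by exact hx), add_zero]
      unfold truncLog
      by_cases h' : x ∈ Set.Ioo (Real.exp (-τ)) (Real.exp τ)
      · rw [Set.indicator_of_mem h']
        exact hε x (not_le.1 hx)
      · rw [Set.indicator_of_notMem h', abs_zero]; linarith
  rw [integral_add (integrable_const _) i1, integral_indicator_const _ hS] at key
  simp only [integral_const, probReal_univ, smul_eq_mul, one_mul] at key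
  have : ν.real {t : ℝ | ε ≤ |t - 1|} ≤ 1 / 4 := h
  nlinarith

lemma second_bound (δ R C : ℝ) (hδ : 0 < δ) (hR : 0 < R) (hC : 0 < C) (w : ℂ)
    (hre : w.re < 0) (him : δ ≤ w.im) (hw : ‖w‖ ≤ R) (μ : Measure ℝ) [IsProbabilityMeasure μ]
    (hpos : ∀ᵐ t ∂μ, 0 < t)
    (h : |∫ t, (t ^ 2 - 1) / (t ^ 2 + 1) ∂μ| ≤ C * ∫ t, (t - 1) ^ 2 / (t ^ 2 + 1) ∂μ) (z : ℂ)
    (hz : z = ((∫ t, (t ^ 2 - 1) / (t ^ 2 + 1) ∂μ : ℝ) : ℂ)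
        + ∫ t, ((1 + (t : ℂ) * w) / (w - (t : ℂ)))
            * (((t - 1) ^ 2 / (t ^ 2 + 1) : ℝ) : ℂ) ∂μ) :
    |z.re| ≤ ((C + (1 / δ + R)) * ((R ^ 2 + 1) / δ)) * |z.im| := by
  have i2 := psi_integrable μ hpos
  have hbd : ∀ t : ℝ, 0 < t → ‖((1 + (t : ℂ) * w) / (w - (t : ℂ)))
            * (((t - 1) ^ 2 / (t ^ 2 + 1) : ℝ) : ℂ)‖
            ≤ (1 / δ + R) * ((t - 1) ^ 2 / (t ^ 2 + 1)) := by
    intro t ht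
    rw [norm_mul, Complex.norm_real, Real.norm_eq_abs,
      abs_of_nonneg (by positivity : (0:ℝ) ≤ (t - 1) ^ 2 / (t ^ 2 + 1))]
    refine mul_le_mul_of_nonneg_right ?_ (by positivity)
    have h1 : δ ≤ ‖w - (t : ℂ)‖ := by
      have := Complex.abs_im_le_norm (w - (t : ℂ))
      have h' := le_abs_self (w - (t : ℂ)).im
      simp at this h'
      linarith
    have h2 : t ≤ ‖w - (t : ℂ)‖ := by
      have := Complex.abs_re_le_norm (w - (t : ℂ))
      have h' := neg_le_abs (w - (t : ℂ)).re
      simp at this h'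
      linarith
    rw [norm_div, div_le_iff₀ (by linarith)]
    calc ‖1 + (t : ℂ) * w‖ ≤ ‖(1 : ℂ)‖ + ‖(t : ℂ) * w‖ := norm_add_le _ _
      _ = 1 + t * ‖w‖ := by
        rw [norm_mul, Complex.norm_real, Real.norm_eq_abs, abs_of_pos ht, norm_one]
      _ ≤ (1 / δ) * δ + t * R := by
        rw [one_div_mul_cancel hδ.ne']
        gcongr
      _ ≤ (1 / δ) * ‖w - (t : ℂ)‖ + ‖w - (t : ℂ)‖ * R := by gcongr
      _ = _ := by ring
  have hae : ∀ᵐ t : ℝ ∂μ, ‖((1 + (t : ℂ) * w) / (w - (t : ℂ)))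
            * (((t - 1) ^ 2 / (t ^ 2 + 1) : ℝ) : ℂ)‖
            ≤ (1 / δ + R) * ((t - 1) ^ 2 / (t ^ 2 + 1)) := by
    filter_upwards [hpos] with t ht using hbd t ht
  have iF : Integrable (fun t : ℝ => ((1 + (t : ℂ) * w) / (w - (t : ℂ)))
            * (((t - 1) ^ 2 / (t ^ 2 + 1) : ℝ) : ℂ)) μ := by
    refine Integrable.mono' (i2.const_mul (1 / δ + R)) ?_ hae
    exact Measurable.aestronglyMeasurable (by fun_prop)
  have hn := norm_integral_le_of_norm_le (i2.const_mul (1 / δ + R)) hae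
  rw [integral_const_mul] at hn
  have himag : δ / (R ^ 2 + 1) * ∫ t, (t - 1) ^ 2 / (t ^ 2 + 1) ∂μ ≤ - z.im := by
    rw [hz, Complex.add_im, Complex.ofReal_im, zero_add]
    have e : (∫ t : ℝ, ((1 + (t : ℂ) * w) / (w - (t : ℂ)))
            * (((t - 1) ^ 2 / (t ^ 2 + 1) : ℝ) : ℂ) ∂μ).im
        = ∫ t : ℝ, (((1 + (t : ℂ) * w) / (w - (t : ℂ)))
            * (((t - 1) ^ 2 / (t ^ 2 + 1) : ℝ) : ℂ)).im ∂μ := by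
      exact (integral_im (𝕜 := ℂ) iF).symm
    rw [e, ← integral_neg, ← integral_const_mul]
    refine integral_mono_ae (i2.const_mul _) iF.im.neg ?_
    filter_upwards [hpos] with t ht
    have hns : 0 < (w.re - t) ^ 2 + w.im ^ 2 := by
      have : 0 < w.im := by linarith
      positivity
    have e2 : (((1 + (t : ℂ) * w) / (w - (t : ℂ)))
            * (((t - 1) ^ 2 / (t ^ 2 + 1) : ℝ) : ℂ)).im
        = - (w.im * (t ^ 2 + 1) / ((w.re - t) ^ 2 + w.im ^ 2) * ((t - 1) ^ 2 / (t ^ 2 + 1))) := by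
      rw [Complex.im_mul_ofReal, ← neg_mul]
      congr 1
      rw [Complex.div_im, Complex.normSq_apply]
      simp
      field_simp
      ring
    rw [e2, neg_neg]
    refine mul_le_mul_of_nonneg_right ?_ (by positivity)
    rw [div_le_div_iff₀ (by positivity) hns]
    have hsq : w.re ^ 2 + w.im ^ 2 ≤ R ^ 2 := by
      have := Complex.sq_norm w
      rw [Complex.normSq_apply] at this
      nlinarith [norm_nonneg w]
    have hre' : -w.re ≤ R := by
      have := Complex.abs_re_le_norm w
      have := neg_le_abs w.re
      linarith
    have h1 : (w.re - t) ^ 2 + w.im ^ 2 ≤ (t ^ 2 + 1) * (R ^ 2 + 1) := by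
      nlinarith [sq_nonneg (R * t - 1)]
    calc δ * ((w.re - t) ^ 2 + w.im ^ 2) ≤ w.im * ((t ^ 2 + 1) * (R ^ 2 + 1)) := by
          apply mul_le_mul him h1 hns.le; linarith
      _ = _ := by ring
  have hrebd : |z.re| ≤ (C + (1 / δ + R)) * ∫ t, (t - 1) ^ 2 / (t ^ 2 + 1) ∂μ := by
    rw [hz, Complex.add_re, Complex.ofReal_re, add_mul]
    exact (abs_add_le _ _).trans (add_le_add h ((Complex.abs_re_le_norm _).trans hn))
  have hI : ∫ t, (t - 1) ^ 2 / (t ^ 2 + 1) ∂μ ≤ (R ^ 2 + 1) / δ * |z.im| := by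
    have := himag.trans (neg_le_abs z.im)
    rw [div_mul_eq_mul_div, div_le_iff₀ (by positivity)] at this
    rw [div_mul_eq_mul_div, le_div_iff₀ hδ]
    linarith
  rw [mul_assoc]
  exact hrebd.trans (mul_le_mul_of_nonneg_left hI (by positivity))


/-- Let `{ν_{nk} : n ≥ 1, 1 ≤ k ≤ k_n}` be an infinitesimal triangular array of Borel
probability measures on `ℝ₊ = (0, +∞)`, fix `τ > 0`, and define
`b_{nk} = exp(∫_{e^{−τ}}^{e^{τ}} log t dν_{nk}(t))`, the centered measure `ν°_{nk}` as the
pushforward of `ν_{nk}` under `t ↦ t/b_{nk}`, `ν̂_{nk}` as the pushforward of `ν°_{nk}`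
under `t ↦ 1/t`, and for `w ∈ ℂ ∖ [0, +∞)`
`g_{nk}(w) = ∫₀^∞ (t² − 1)/(t² + 1) dν̂_{nk}(t)
  + ∫₀^∞ [(1 + tw)/(w − t)] (t − 1)²/(t² + 1) dν̂_{nk}(t)`.
Then for every compact `K ⊆ {Re w < 0, Im w > 0}` there is `M = M(τ, K) > 0` such that for
all sufficiently large `n`: `|Re g_{nk}(w)| ≤ M |Im g_{nk}(w)|` for `w ∈ K`, `1 ≤ k ≤ k_n`. -/
theorem stmt_3
    (kn : ℕ → ℕ) (hkn : ∀ n, 1 ≤ kn n)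
    (ν : ℕ → ℕ → Measure ℝ)
    (hprob : ∀ n k, IsProbabilityMeasure (ν n k))
    (hpos : ∀ n k, ν n k (Set.Ioi (0 : ℝ))ᶜ = 0)
    (hinf : ∀ ε > (0 : ℝ), ∀ δ > (0 : ℝ), ∀ᶠ n in atTop, ∀ k, 1 ≤ k → k ≤ kn n →
      (ν n k {t : ℝ | ε ≤ |t - 1|}).toReal ≤ δ)
    (τ : ℝ) (hτ : 0 < τ)
    (b : ℕ → ℕ → ℝ)
    (hb : ∀ n k, b n k
      = Real.exp (∫ t in Set.Ioo (Real.exp (-τ)) (Real.exp τ), Real.log t ∂(ν n k)))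
    (νc : ℕ → ℕ → Measure ℝ)
    (hνc : ∀ n k, νc n k = Measure.map (fun t => t / b n k) (ν n k))
    (νhat : ℕ → ℕ → Measure ℝ)
    (hνhat : ∀ n k, νhat n k = Measure.map (fun t => 1 / t) (νc n k))
    (g : ℕ → ℕ → ℂ → ℂ)
    (hg : ∀ n k w, g n k w
      = ((∫ t, (t ^ 2 - 1) / (t ^ 2 + 1) ∂(νhat n k) : ℝ) : ℂ)
        + ∫ t, ((1 + (t : ℂ) * w) / (w - (t : ℂ)))
            * (((t - 1) ^ 2 / (t ^ 2 + 1) : ℝ) : ℂ) ∂(νhat n k)) :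
    ∀ K : Set ℂ, IsCompact K → K ⊆ {w : ℂ | w.re < 0 ∧ 0 < w.im} →
      ∃ M > (0 : ℝ), ∀ᶠ n in atTop, ∀ k, 1 ≤ k → k ≤ kn n → ∀ w ∈ K,
        |(g n k w).re| ≤ M * |(g n k w).im| := by
  intro K hK hKs
  obtain ⟨R0, hR0⟩ := hK.isBounded.exists_norm_le
  obtain ⟨δ, hδ, hδK⟩ : ∃ δ > (0 : ℝ), ∀ w ∈ K, δ ≤ w.im := by
    rcases K.eq_empty_or_nonempty with h | h
    · exact ⟨1, one_pos, by simp [h]⟩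
    · obtain ⟨w0, hw0, hmin⟩ := hK.exists_isMinOn h Complex.continuous_im.continuousOn
      exact ⟨w0.im, (hKs hw0).2, fun w hw => hmin hw⟩
  obtain ⟨ε, hε, hεlog⟩ : ∃ ε > (0 : ℝ), ∀ t : ℝ, |t - 1| < ε → |Real.log t| ≤ τ / 4 := by
    have hc := Metric.continuousAt_iff.1 (Real.continuousAt_log one_ne_zero) (τ / 4) (by positivity)
    obtain ⟨ε, hε, h⟩ := hc
    refine ⟨ε, hε, fun t ht => ?_⟩
    have := h (x := t) (by rwa [Real.dist_eq])
    rw [Real.dist_eq, Real.log_one, sub_zero] at this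
    exact this.le
  have hR : 0 < |R0| + 1 := by positivity
  have hC := cst_pos τ hτ
  refine ⟨(cst τ + (1 / δ + (|R0| + 1))) * (((|R0| + 1) ^ 2 + 1) / δ), by positivity, ?_⟩
  filter_upwards [hinf ε hε (1 / 4) (by norm_num)] with n hn k hk1 hk2 w hw
  have := hprob n k
  have hp : ∀ᵐ t ∂(ν n k), 0 < t := by
    rw [ae_iff]
    exact hpos n k
  have hbe : b n k = Real.exp (∫ x, truncLog τ x ∂(ν n k)) := by
    rw [hb]
    unfold truncLog
    rw [integral_indicator measurableSet_Ioo]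
  have hμ : νhat n k = Measure.map
      (fun x => 1 / (x / Real.exp (∫ x, truncLog τ x ∂(ν n k)))) (ν n k) := by
    rw [hνhat, hνc, Measure.map_map (by fun_prop) (by fun_prop), hbe]
    rfl
  have hm : Measurable (fun x : ℝ => 1 / (x / Real.exp (∫ x, truncLog τ x ∂(ν n k)))) := by
    fun_prop
  have hpr : IsProbabilityMeasure (νhat n k) := by
    rw [hμ]; exact Measure.isProbabilityMeasure_map hm.aemeasurable
  have hμpos : ∀ᵐ t ∂(νhat n k), 0 < t := by
    rw [hμ, ae_map_iff hm.aemeasurable measurableSet_Ioi]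
    filter_upwards [hp] with x hx
    positivity
  have hfb := first_bound τ _ hτ (ν n k) (νhat n k) hp
    (center_bound τ ε hτ hεlog (ν n k) (hn k hk1 hk2)) rfl hμ
  exact second_bound δ (|R0| + 1) (cst τ) hδ hR hC w (hKs hw).1 (hδK w hw)
    ((hR0 w hw).trans (by linarith [le_abs_self R0])) (νhat n k) hμpos hfb _ (hg n k w)
end

section
/- Let ρ be a Borel probability measure on ℝ and set a = ∫_{(−1,1)} x dρ(x). If |a| ≤ 1/2, then |∫_ℝ (1 − e^{2(x−a)})/(1 + e^{2(x−a)}) dρ(x)| ≤ 74 ∫_ℝ (1 − e^{x−a})²/(1 + e^{2(x−a)}) dρ(x). -/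
open MeasureTheory

lemma aux_sinh_le {y : ℝ} (hy : 0 ≤ y) : Real.sinh y ≤ y * Real.cosh y := by
  have hmono : MonotoneOn (fun t : ℝ => t * Real.cosh t - Real.sinh t) (Set.Ici 0) := by
    apply monotoneOn_of_deriv_nonneg (convex_Ici 0)
    · fun_prop
    · fun_prop
    · intro t ht
      rw [interior_Ici] at ht
      have h : HasDerivAt (fun t : ℝ => t * Real.cosh t - Real.sinh t)
          (1 * Real.cosh t + t * Real.sinh t - Real.cosh t) t :=
        ((hasDerivAt_id t).mul (Real.hasDerivAt_cosh t)).sub (Real.hasDerivAt_sinh t)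
      rw [h.deriv]
      have := mul_nonneg (le_of_lt ht) (Real.sinh_nonneg_iff.2 (le_of_lt ht))
      linarith
  have := hmono (Set.mem_Ici.2 le_rfl) (Set.mem_Ici.2 hy) hy
  simp at this
  linarith

lemma aux_cosh (y : ℝ) : 1 + y ^ 2 / 2 ≤ Real.cosh y := by
  have h : Real.cosh y = 1 + 2 * Real.sinh (y / 2) ^ 2 := by
    have h1 := Real.cosh_two_mul (y / 2)
    have h2 := Real.cosh_sq (y / 2)
    rw [mul_div_cancel₀ y two_ne_zero] at h1
    linarith
  have h3 : (y / 2) ^ 2 ≤ Real.sinh (y / 2) ^ 2 := by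
    rw [sq_le_sq]
    rcases le_total 0 (y / 2) with h0 | h0
    · rw [abs_of_nonneg h0, abs_of_nonneg (Real.sinh_nonneg_iff.2 h0)]
      exact Real.self_le_sinh_iff.2 h0
    · rw [abs_of_nonpos h0, abs_of_nonpos (Real.sinh_nonpos_iff.2 h0)]
      have := Real.sinh_le_self_iff.2 h0
      linarith
  rw [h]; nlinarith

lemma aux_f (y : ℝ) :
    (1 - Real.exp (2 * y)) / (1 + Real.exp (2 * y)) = - (Real.sinh y / Real.cosh y) := by
  have h1 := Real.exp_pos y
  rw [Real.sinh_eq, Real.cosh_eq, two_mul, Real.exp_add, Real.exp_neg]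
  field_simp
  ring

lemma aux_g (y : ℝ) :
    (1 - Real.exp y) ^ 2 / (1 + Real.exp (2 * y)) = (Real.cosh y - 1) / Real.cosh y := by
  have h1 := Real.exp_pos y
  rw [Real.cosh_eq, two_mul, Real.exp_add, Real.exp_neg]
  field_simp
  ring

lemma aux_in {y : ℝ} (hy : |y| ≤ 3 / 2) :
    |y - Real.sinh y / Real.cosh y| ≤ 74 * ((Real.cosh y - 1) / Real.cosh y) := by
  have hc := Real.cosh_pos y
  have hc1 := Real.one_le_cosh y
  have e : y - Real.sinh y / Real.cosh y = (y * Real.cosh y - Real.sinh y) / Real.cosh y := by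
    field_simp
  rw [e, abs_div, abs_of_pos hc, ← mul_div_assoc]
  apply div_le_div_of_nonneg_right _ hc.le
  obtain ⟨h1, h2⟩ := abs_le.1 hy
  rw [abs_le]
  rcases le_total 0 y with h0 | h0
  · have a1 := aux_sinh_le h0
    have a2 := Real.self_le_sinh_iff.2 h0
    constructor <;> nlinarith
  · have a1 := aux_sinh_le (neg_nonneg.2 h0)
    rw [Real.sinh_neg, Real.cosh_neg] at a1
    have a2 := Real.sinh_le_self_iff.2 h0
    constructor <;> nlinarith

lemma aux_tanh (y : ℝ) : |Real.sinh y / Real.cosh y| ≤ 1 := by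
  have hc := Real.cosh_pos y
  rw [abs_div, abs_of_pos hc, div_le_one hc]
  apply abs_le_of_sq_le_sq _ hc.le
  have := Real.cosh_sq y
  linarith

lemma aux_out {y a : ℝ} (ha : |a| ≤ 1 / 2) (hy : 1 / 2 ≤ |y|) :
    |-a - Real.sinh y / Real.cosh y| ≤ 74 * ((Real.cosh y - 1) / Real.cosh y) := by
  have hc := Real.cosh_pos y
  have h1 := aux_cosh y
  have h2 : 1 / 4 ≤ y ^ 2 := by rw [← sq_abs]; nlinarith
  have h3 : 1 / 9 ≤ (Real.cosh y - 1) / Real.cosh y := by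
    rw [le_div_iff₀ hc]; linarith
  have h4 := abs_le.1 (aux_tanh y)
  have h5 := abs_le.1 ha
  rw [abs_le]
  constructor <;> linarith [h4.1, h4.2, h5.1, h5.2]

/-- Let `ρ` be a Borel probability measure on `ℝ` and `a = ∫_{(−1,1)} x dρ(x)`.
If `|a| ≤ 1/2`, then
`|∫ (1 − e^{2(x−a)})/(1 + e^{2(x−a)}) dρ| ≤ 74 ∫ (1 − e^{x−a})²/(1 + e^{2(x−a)}) dρ`. -/
theorem stmt_4 (ρ : Measure ℝ) [IsProbabilityMeasure ρ]
    (a : ℝ) (ha : a = ∫ x in Set.Ioo (-1 : ℝ) 1, x ∂ρ) (ha2 : |a| ≤ 1 / 2) :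
    |∫ x, (1 - Real.exp (2 * (x - a))) / (1 + Real.exp (2 * (x - a))) ∂ρ|
      ≤ 74 * ∫ x, (1 - Real.exp (x - a)) ^ 2 / (1 + Real.exp (2 * (x - a))) ∂ρ := by
  simp only [aux_f, aux_g]
  have hcont : Continuous fun x : ℝ => Real.sinh (x - a) / Real.cosh (x - a) :=
    Continuous.div (by fun_prop) (by fun_prop) (fun x => (Real.cosh_pos _).ne')
  have hcont2 : Continuous fun x : ℝ => (Real.cosh (x - a) - 1) / Real.cosh (x - a) :=
    Continuous.div (by fun_prop) (by fun_prop) (fun x => (Real.cosh_pos _).ne')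
  have hf : Integrable (fun x : ℝ => Real.sinh (x - a) / Real.cosh (x - a)) ρ :=
    Integrable.of_bound hcont.aestronglyMeasurable 1
      (Filter.Eventually.of_forall fun x => aux_tanh _)
  have hg : Integrable (fun x : ℝ => (Real.cosh (x - a) - 1) / Real.cosh (x - a)) ρ := by
    refine Integrable.of_bound hcont2.aestronglyMeasurable 1
      (Filter.Eventually.of_forall fun x => ?_)
    have hc := Real.cosh_pos (x - a)
    have hc1 := Real.one_le_cosh (x - a)
    rw [Real.norm_eq_abs, abs_of_nonneg (div_nonneg (by linarith) hc.le), div_le_one hc]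
    linarith
  have hI : Integrable ((Set.Ioo (-1 : ℝ) 1).indicator fun x : ℝ => x) ρ := by
    refine Integrable.of_bound
      ((measurable_id.indicator measurableSet_Ioo).aestronglyMeasurable) 1
      (Filter.Eventually.of_forall fun x => ?_)
    by_cases hx : x ∈ Set.Ioo (-1 : ℝ) 1
    · rw [Set.indicator_of_mem hx, Real.norm_eq_abs, abs_le]
      exact ⟨hx.1.le, hx.2.le⟩
    · rw [Set.indicator_of_notMem hx]; simp
  have key : ∫ x, -(Real.sinh (x - a) / Real.cosh (x - a)) ∂ρ
      = ∫ x, ((Set.Ioo (-1 : ℝ) 1).indicator (fun x : ℝ => x) x - a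
          - Real.sinh (x - a) / Real.cosh (x - a)) ∂ρ := by
    have hIa : Integrable (fun x => (Set.Ioo (-1 : ℝ) 1).indicator (fun x : ℝ => x) x - a) ρ :=
      hI.sub (integrable_const a)
    rw [integral_sub hIa hf, integral_sub hI (integrable_const a),
      integral_indicator measurableSet_Ioo, ← ha, integral_neg]
    simp
  rw [key, ← integral_const_mul, ← Real.norm_eq_abs]
  refine norm_integral_le_of_norm_le (hg.const_mul 74) (Filter.Eventually.of_forall fun x => ?_)
  rw [Real.norm_eq_abs]
  have h5 := abs_le.1 ha2
  by_cases hx : x ∈ Set.Ioo (-1 : ℝ) 1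
  · rw [Set.indicator_of_mem hx]
    apply aux_in
    rw [abs_le]
    constructor <;> linarith [hx.1, hx.2, h5.1, h5.2]
  · rw [Set.indicator_of_notMem hx, zero_sub]
    apply aux_out ha2
    rw [le_abs]
    rw [Set.mem_Ioo, not_and_or, not_lt, not_lt] at hx
    rcases hx with hx | hx
    · right; linarith [h5.1]
    · left; linarith [h5.2]
end

section
/- For every real number x with |x| ≥ 1/2, one has (1 − e^x)²/(1 + e^{2x}) ≥ (1 − √e)²/(1 + e), where e is Euler's number and √e = e^{1/2}. -/
/-- For every real `x` with `|x| ≥ 1/2`, one has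
`(1 − e^x)²/(1 + e^{2x}) ≥ (1 − √e)²/(1 + e)`. -/
theorem stmt_6 (x : ℝ) (hx : 1 / 2 ≤ |x|) :
    (1 - Real.exp ((1:ℝ) / 2)) ^ 2 / (1 + Real.exp 1) ≤
      (1 - Real.exp x) ^ 2 / (1 + Real.exp (2 * x)) := by
  have h1 : Real.exp 1 = Real.exp ((1:ℝ) / 2) ^ 2 := by
    rw [pow_two, ← Real.exp_add]; norm_num
  have h2 : Real.exp (2 * x) = Real.exp x ^ 2 := by
    rw [pow_two, ← Real.exp_add, two_mul]
  have key : (Real.exp x - Real.exp ((1:ℝ) / 2)) *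
      (1 - Real.exp ((1:ℝ) / 2) * Real.exp x) ≤ 0 := by
    rw [← Real.exp_add]
    rcases le_abs.mp hx with h | h
    · apply mul_nonpos_of_nonneg_of_nonpos
      · exact sub_nonneg.mpr (Real.exp_le_exp.mpr h)
      · exact sub_nonpos.mpr (Real.one_le_exp (by linarith))
    · apply mul_nonpos_of_nonpos_of_nonneg
      · exact sub_nonpos.mpr (Real.exp_le_exp.mpr (by linarith))
      · exact sub_nonneg.mpr (Real.exp_le_one_iff.mpr (by linarith))
  rw [h1, h2, div_le_div_iff₀ (by positivity) (by positivity)]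
  linarith [key]
end

section
/- For every real number x with −2 ≤ x ≤ 2, one has |sin x − x| ≤ 2(1 − cos x). -/
theorem stmt_12_aux (x : ℝ) (hx1 : 0 < x) (hx2 : x ≤ 2) :
    |Real.sin x - x| ≤ 2 * (1 - Real.cos x) := by
  have h1 := Real.sin_gt_sub_cube hx1
  have h2 := Real.sin_lt hx1
  have h3 := Real.sin_gt_sub_cube (half_pos hx1)
  have h4 : Real.cos x = 1 - 2 * Real.sin (x / 2) ^ 2 := by
    have h5 := Real.cos_two_mul (x / 2)
    rw [mul_div_cancel₀ x (two_ne_zero)] at h5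
    have h6 := Real.sin_sq_add_cos_sq (x / 2)
    linarith
  have hx3 : x ^ 2 ≤ 4 := by nlinarith
  have hx4 : x ^ 3 ≤ 4 * x := by nlinarith
  have hx5 : x ^ 3 ≤ 2 * x ^ 2 := by nlinarith [sq_nonneg x]
  have h7 : 5 / 12 * x ≤ Real.sin (x / 2) := by
    ring_nf at h3 ⊢
    linarith
  have h8 : (5 / 12 * x) ^ 2 ≤ Real.sin (x / 2) ^ 2 :=
    pow_le_pow_left₀ (by positivity) h7 2
  rw [abs_of_neg (by linarith), h4]
  nlinarith [sq_nonneg x]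

/-- For every real `x` with `−2 ≤ x ≤ 2`, one has `|sin x − x| ≤ 2(1 − cos x)`. -/
theorem stmt_12 (x : ℝ) (hx1 : -2 ≤ x) (hx2 : x ≤ 2) :
    |Real.sin x - x| ≤ 2 * (1 - Real.cos x) := by
  rcases lt_trichotomy x 0 with h | h | h
  · have := stmt_12_aux (-x) (by linarith) (by linarith)
    rw [Real.sin_neg, Real.cos_neg, ← abs_neg] at this
    convert this using 2
    ring
  · subst h
    simp
  · exact stmt_12_aux x h hx2
end

section
/- For every real number x with 9/10 ≤ |x| ≤ π + 9/10, one has 1/10 + |sin x| ≤ 10(1 − cos x). -/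
/-- For every real `x` with `9/10 ≤ |x| ≤ π + 9/10`, one has
`1/10 + |sin x| ≤ 10(1 − cos x)`. -/
theorem stmt_13 (x : ℝ) (hx1 : 9 / 10 ≤ |x|) (hx2 : |x| ≤ Real.pi + 9 / 10) :
    1 / 10 + |Real.sin x| ≤ 10 * (1 - Real.cos x) := by
  have hs := Real.abs_sin_le_one x
  have hp := Real.pi_gt_three
  have hp2 := Real.pi_lt_d2
  suffices h : Real.cos x ≤ 89 / 100 by linarith
  rcases le_total |x| Real.pi with h | h
  · have h1 := Real.cos_le_one_sub_mul_cos_sq h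
    have h2 : 11 / 100 ≤ 2 / Real.pi ^ 2 * x ^ 2 := by
      rw [← sq_abs x, div_mul_eq_mul_div, le_div_iff₀ (by positivity)]
      nlinarith
    linarith
  · rw [← Real.cos_abs]
    have := Real.cos_nonpos_of_pi_div_two_le_of_le (x := |x|) (by linarith) (by linarith)
    linarith
end

section
/- Let ρ be a Borel probability measure on ℝ whose support is contained in [−π, π), and set a = ∫_{(−1,1)} x dρ(x). If |a| ≤ 1/10, then |∫_ℝ sin(x − a) dρ(x)| ≤ 12 ∫_ℝ (1 − cos(x − a)) dρ(x). -/
open MeasureTheory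

lemma aux_cos {y : ℝ} (h : |y| ≤ Real.pi) : y ^ 2 / 5 ≤ 1 - Real.cos y := by
  have h1 := Real.cos_le_one_sub_mul_cos_sq h
  have h2 : (1:ℝ) / 5 ≤ 2 / Real.pi ^ 2 := by
    rw [div_le_div_iff₀ (by norm_num) (by positivity)]
    nlinarith [Real.pi_lt_d2, Real.pi_gt_three]
  nlinarith [sq_nonneg y]

lemma aux_sin0 {y : ℝ} (h0 : 0 ≤ y) (h : y ≤ 11/10) :
    |Real.sin y - y| ≤ 12 * (1 - Real.cos y) := by
  have h1 := Real.sin_le h0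
  have h2 : y ≤ Real.tan y := Real.le_tan h0 (by linarith [Real.pi_gt_three])
  have hc : 0 < Real.cos y := Real.cos_pos_of_mem_Ioo
    ⟨by linarith [Real.pi_gt_three], by linarith [Real.pi_gt_three]⟩
  rw [Real.tan_eq_sin_div_cos, le_div_iff₀ hc] at h2
  rw [abs_le]
  constructor <;> nlinarith [Real.cos_le_one y]

lemma aux_sin {y : ℝ} (h : |y| ≤ 11/10) :
    |Real.sin y - y| ≤ 12 * (1 - Real.cos y) := by
  rcases le_total 0 y with h0 | h0
  · exact aux_sin0 h0 (le_trans (le_abs_self y) h)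
  · have := aux_sin0 (y := -y) (by linarith) (le_trans (neg_le_abs y) h)
    rw [Real.sin_neg, Real.cos_neg, ← abs_neg] at this
    convert this using 2
    ring

lemma aux_out_s14 {y : ℝ} (h : 9/10 ≤ |y|) (h' : |y| ≤ Real.pi + 1/10) :
    11/10 ≤ 12 * (1 - Real.cos y) := by
  rcases le_total |y| Real.pi with hy | hy
  · have := aux_cos hy
    have : (9/10)^2 ≤ y^2 := by rw [← sq_abs y]; gcongr
    linarith
  · have : Real.cos |y| ≤ 0 := Real.cos_nonpos_of_pi_div_two_le_of_le
      (by linarith [Real.pi_gt_three]) (by linarith [Real.pi_gt_three])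
    rw [Real.cos_abs] at this
    linarith

/-- Let `ρ` be a Borel probability measure on `ℝ` supported in `[−π, π)` and
`a = ∫_{(−1,1)} x dρ(x)`.  If `|a| ≤ 1/10`, then
`|∫ sin(x − a) dρ(x)| ≤ 12 ∫ (1 − cos(x − a)) dρ(x)`. -/
theorem stmt_14 (ρ : Measure ℝ) [IsProbabilityMeasure ρ]
    (hsupp : ρ (Set.Ico (-Real.pi) Real.pi)ᶜ = 0)
    (a : ℝ) (ha : a = ∫ x in Set.Ioo (-1 : ℝ) 1, x ∂ρ) (ha2 : |a| ≤ 1 / 10) :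
    |∫ x, Real.sin (x - a) ∂ρ| ≤ 12 * ∫ x, (1 - Real.cos (x - a)) ∂ρ := by
  have hs : Integrable (fun x => Real.sin (x - a)) ρ :=
    Integrable.of_bound (C := 1) (by fun_prop)
      (Filter.Eventually.of_forall fun x => by simpa using Real.abs_sin_le_one _)
  have hc : Integrable (fun x => 1 - Real.cos (x - a)) ρ :=
    (integrable_const _).sub (Integrable.of_bound (C := 1) (by fun_prop)
      (Filter.Eventually.of_forall fun x => by simpa using Real.abs_cos_le_one _))
  have hg : Integrable ((Set.Ioo (-1 : ℝ) 1).indicator (fun x => x)) ρ := by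
    refine Integrable.of_bound (C := 1)
      ((measurable_id.indicator measurableSet_Ioo).aestronglyMeasurable)
      (Filter.Eventually.of_forall fun x => ?_)
    by_cases hx : x ∈ Set.Ioo (-1 : ℝ) 1
    · rw [Set.indicator_of_mem hx, Real.norm_eq_abs, abs_le]
      exact ⟨hx.1.le, hx.2.le⟩
    · rw [Set.indicator_of_notMem hx]; simp
  have hg2 : Integrable (fun x => (Set.Ioo (-1 : ℝ) 1).indicator (fun x => x) x - a) ρ :=
    hg.sub (integrable_const a)
  have hg0 : ∫ x, ((Set.Ioo (-1 : ℝ) 1).indicator (fun x => x) x - a) ∂ρ = 0 := by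
    rw [integral_sub hg (integrable_const a), integral_indicator measurableSet_Ioo, ← ha]
    simp
  have key : ∫ x, Real.sin (x - a) ∂ρ = ∫ x, (Real.sin (x - a) -
      ((Set.Ioo (-1 : ℝ) 1).indicator (fun x => x) x - a)) ∂ρ := by
    rw [integral_sub hs hg2, hg0, sub_zero]
  rw [key, ← integral_const_mul, ← Real.norm_eq_abs]
  refine norm_integral_le_of_norm_le (hc.const_mul 12) ?_
  have hae : ∀ᵐ x ∂ρ, x ∈ Set.Ico (-Real.pi) Real.pi := hsupp
  filter_upwards [hae] with x hx
  rw [Real.norm_eq_abs]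
  have ha3 := abs_le.1 ha2
  by_cases hx1 : x ∈ Set.Ioo (-1 : ℝ) 1
  · rw [Set.indicator_of_mem hx1]
    exact aux_sin (abs_le.2 ⟨by linarith [hx1.1], by linarith [hx1.2]⟩)
  · rw [Set.indicator_of_notMem hx1]
    have hx2 : 1 ≤ |x| := by
      by_contra hlt
      exact hx1 (abs_lt.1 (not_le.1 hlt))
    have h3 : |x| ≤ Real.pi := abs_le.2 ⟨hx.1, hx.2.le⟩
    have h4 := abs_sub_abs_le_abs_sub x a
    have h5 := abs_sub x a
    have h6 := aux_out_s14 (y := x - a) (by linarith) (by linarith)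
    refine le_trans ?_ h6
    have := abs_le.1 (Real.abs_sin_le_one (x - a))
    rw [abs_le]
    constructor <;> linarith
end

section
/- Let (σ_n) be a sequence of finite positive Borel measures on (0, +∞) and (γ_n) a sequence of real numbers. Let σ₀ be a finite positive Borel measure on [0, +∞), let c ≥ 0 and γ ∈ ℝ, and let U be a nonempty open subset of {w ∈ ℂ : Re w < 0 and Im w > 0}. Suppose that for every w ∈ U, γ_n + ∫_{(0,∞)} (1 + tw)/(w − t) dσ_n(t) → γ + ∫_{[0,∞)} (1 + tw)/(w − t) dσ₀(t) − c·w as n → ∞. Then γ_n → γ, and for every bounded continuous function f : [0, +∞) → ℝ that has a finite limit L_f at +∞, one has ∫_{(0,∞)} f dσ_n → ∫_{[0,∞)} f dσ₀ + c·L_f. -/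
open MeasureTheory Filter Topology

/-- The unit interval coordinate as a complex function. -/
noncomputable def stX : C(Set.Icc (0:ℝ) 1, ℂ) := ⟨fun x => ((x : ℝ) : ℂ), by fun_prop⟩

/-- The resolvent element. -/
noncomputable def stR (s : ℂ) : C(Set.Icc (0:ℝ) 1, ℂ) := Ring.inverse (1 - (1 - s) • stX)

/-- The kernel with `s = -w`. -/
noncomputable def stK (s : ℂ) : C(Set.Icc (0:ℝ) 1, ℂ) :=
  s • (1 : C(Set.Icc (0:ℝ) 1, ℂ)) - (1 + s ^ 2) • (stX * stR s)

lemma stX_apply (x : Set.Icc (0:ℝ) 1) : stX x = ((x : ℝ) : ℂ) := rfl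

lemma st_ne {s : ℂ} (hs : s ∈ Complex.slitPlane) (x : Set.Icc (0:ℝ) 1) :
    1 - (1 - s) * ((x : ℝ) : ℂ) ≠ 0 := by
  intro h
  obtain ⟨x, hx0, hx1⟩ := x
  simp only at h
  have h1 := congrArg Complex.re h
  have h2 := congrArg Complex.im h
  simp at h1 h2
  rw [Complex.mem_slitPlane_iff] at hs
  rcases h2 with h2 | h2
  · rcases hs with hs | hs
    · rcases hx0.eq_or_lt with h0 | h0
      · subst h0; simp at h1
      · nlinarith [mul_pos hs h0]
    · exact hs h2
  · subst h2; simp at h1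

lemma st_unit {s : ℂ} (hs : s ∈ Complex.slitPlane) :
    IsUnit (1 - (1 - s) • stX) := by
  rw [ContinuousMap.isUnit_iff_forall_ne_zero]
  intro x
  simpa [stX_apply] using st_ne hs x

lemma stR_apply {s : ℂ} (hs : s ∈ Complex.slitPlane) (x : Set.Icc (0:ℝ) 1) :
    stR s x = (1 - (1 - s) * ((x : ℝ) : ℂ))⁻¹ := by
  have h := Ring.mul_inverse_cancel _ (st_unit hs)
  have h2 := congrArg (fun f => f x) h
  simp [stX_apply] at h2
  exact eq_inv_of_mul_eq_one_right h2

lemma stK_apply {s : ℂ} (hs : s ∈ Complex.slitPlane) (x : Set.Icc (0:ℝ) 1) :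
    stK s x = s - (1 + s ^ 2) * (((x : ℝ) : ℂ) * (1 - (1 - s) * ((x : ℝ) : ℂ))⁻¹) := by
  simp [stK, stR_apply hs, stX_apply]

lemma stR_diff {s : ℂ} (hs : s ∈ Complex.slitPlane) : DifferentiableAt ℂ stR s := by
  unfold stR
  exact DifferentiableAt.inverse (h := fun s : ℂ => 1 - (1 - s) • stX) (by fun_prop) (st_unit hs)

lemma st_key {E : Type*} [NormedAddCommGroup E] [NormedSpace ℂ E] [CompleteSpace E]
    (T : C(Set.Icc (0:ℝ) 1, ℂ) →L[ℂ] E) (s₀ : ℂ) (hs₀ : s₀ ∈ Complex.slitPlane)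
    (h : ∀ᶠ s in 𝓝 s₀, T (stK s) = T (stK s₀)) (k : ℕ) : T (stX ^ k) = 0 := by
  have hpre : IsPreconnected Complex.slitPlane :=
    (Complex.starConvex_one_slitPlane.isPathConnected (by simp [Complex.mem_slitPlane_iff])).isConnected.isPreconnected
  have hdiff : DifferentiableOn ℂ (fun s => T (stK s)) Complex.slitPlane := by
    intro s hs
    have := stR_diff hs
    have h2 : DifferentiableAt ℂ stK s := by
      unfold stK
      fun_prop
    exact (T.differentiableAt.comp s h2).differentiableWithinAt
  have hc : Set.EqOn (fun s => T (stK s)) (fun _ => T (stK s₀)) Complex.slitPlane :=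
    (hdiff.analyticOnNhd Complex.isOpen_slitPlane).eqOn_of_preconnected_of_eventuallyEq
      analyticOnNhd_const hpre hs₀ h
  have hI := hc (show Complex.I ∈ Complex.slitPlane by simp [Complex.mem_slitPlane_iff])
  have hnI := hc (show -Complex.I ∈ Complex.slitPlane by simp [Complex.mem_slitPlane_iff])
  have kI : stK Complex.I = Complex.I • 1 := by ext x; simp [stK]
  have knI : stK (-Complex.I) = -(Complex.I • 1) := by
    ext x; simp [stK]
  simp only [kI, knI, map_neg, map_smul] at hI hnI
  have h1 : T 1 = 0 := by
    have h3 : (2 * Complex.I) • T 1 = 0 := by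
      rw [two_mul, add_smul]
      nth_rw 1 [hI]
      rw [← hnI]; simp
    simpa using h3
  have h0 : ∀ s ∈ Complex.slitPlane, T (stK s) = 0 := by
    intro s hs
    have h5 := hc hs
    simp only at h5
    rw [h5, ← hI, h1]; simp
  have hG : ∀ s ∈ Complex.slitPlane, 1 + s ^ 2 ≠ 0 → T (stX * stR s) = 0 := by
    intro s hs hne
    have := h0 s hs
    simpa [stK, h1, hne] using this
  rcases k with _ | k
  · simpa using h1
  have hps := (spectrum.hasFPowerSeriesOnBall_inverse_one_sub_smul ℂ stX)
  let T' : C(Set.Icc (0:ℝ) 1, ℂ) →L[ℂ] E := T.comp (ContinuousLinearMap.mul ℂ _ stX)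
  have hps' := T'.comp_hasFPowerSeriesOnBall hps
  have hev : (T' ∘ fun z : ℂ => Ring.inverse (1 - z • stX)) =ᶠ[𝓝 0] 0 := by
    have e1 : ∀ᶠ z : ℂ in 𝓝 0, (1 - z) ∈ Complex.slitPlane :=
      (ContinuousAt.preimage_mem_nhds (f := fun z : ℂ => 1 - z) (by fun_prop)
        (Complex.isOpen_slitPlane.mem_nhds (by simp)))
    have e2 : ∀ᶠ z : ℂ in 𝓝 0, 1 + (1 - z) ^ 2 ≠ 0 :=
      ContinuousAt.eventually_ne (g := fun z : ℂ => 1 + (1 - z)^2) (by fun_prop) (by norm_num)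
    filter_upwards [e1, e2] with z hz1 hz2
    have := hG _ hz1 hz2
    simpa [T', stR] using this
  have hz := (hps'.hasFPowerSeriesAt.congr hev).eq_zero
  have hk := congrFun hz k
  have hk2 := congrArg (fun m => m (fun _ => (1:ℂ))) hk
  rw [pow_succ']
  have hk3 : T' ((ContinuousMultilinearMap.mkPiRing ℂ (Fin k) (stX ^ k)) fun _ => (1:ℂ)) = 0 := hk2
  simpa [T', -FormalMultilinearSeries.apply_eq_prod_smul_coeff] using hk3

lemma st_dense (A : Submodule ℂ C(Set.Icc (0:ℝ) 1, ℂ)) (hA : IsClosed (A : Set C(Set.Icc (0:ℝ) 1, ℂ)))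
    (U : Set ℂ) (hU : IsOpen U) (s₀ : ℂ) (hs₀U : s₀ ∈ U) (hs₀ : s₀ ∈ Complex.slitPlane)
    (h : ∀ s ∈ U, stK s - stK s₀ ∈ A) (k : ℕ) : stX ^ k ∈ A := by
  have := hA
  have hev : ∀ᶠ s in 𝓝 s₀, A.mkQL (stK s) = A.mkQL (stK s₀) := by
    filter_upwards [hU.mem_nhds hs₀U] with s hs
    have h2 : A.mkQL (stK s - stK s₀) = 0 := (Submodule.Quotient.mk_eq_zero A).mpr (h s hs)
    exact sub_eq_zero.mp ((map_sub A.mkQL _ _).symm.trans h2)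
  have h3 := st_key (E := C(Set.Icc (0:ℝ) 1, ℂ) ⧸ A) A.mkQL s₀ hs₀ hev k
  exact (Submodule.Quotient.mk_eq_zero A).mp h3

lemma st_real (A : Submodule ℂ C(Set.Icc (0:ℝ) 1, ℂ)) (hA : IsClosed (A : Set C(Set.Icc (0:ℝ) 1, ℂ)))
    (hk : ∀ k : ℕ, stX ^ k ∈ A) (g : C(Set.Icc (0:ℝ) 1, ℝ)) :
    (⟨fun x => (g x : ℂ), by fun_prop⟩ : C(Set.Icc (0:ℝ) 1, ℂ)) ∈ A := by
  let J : C(Set.Icc (0:ℝ) 1, ℝ) → C(Set.Icc (0:ℝ) 1, ℂ) :=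
    fun g => (⟨Complex.ofReal, Complex.continuous_ofReal⟩ : C(ℝ, ℂ)).comp g
  have hJ : Continuous J := ContinuousMap.continuous_postcomp _
  have hcl : IsClosed (J ⁻¹' A) := hA.preimage hJ
  have hsub : (polynomialFunctions (Set.Icc (0:ℝ) 1) : Set C(Set.Icc (0:ℝ) 1, ℝ)) ⊆ J ⁻¹' A := by
    rw [polynomialFunctions_coe]
    rintro _ ⟨p, rfl⟩
    have : J (Polynomial.toContinuousMapOnAlgHom (Set.Icc (0:ℝ) 1) p) =
        ∑ i ∈ Finset.range (p.natDegree + 1), (p.coeff i : ℂ) • stX ^ i := by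
      ext x
      simp [J, Polynomial.eval_eq_sum_range, stX_apply]
    simp only [Set.mem_preimage]
    rw [this]
    exact A.sum_mem fun i _ => A.smul_mem _ (hk i)
  have htop : g ∈ closure (polynomialFunctions (Set.Icc (0:ℝ) 1) : Set C(Set.Icc (0:ℝ) 1, ℝ)) := by
    have := polynomialFunctions_closure_eq_top 0 1
    have h2 : g ∈ (polynomialFunctions (Set.Icc (0:ℝ) 1)).topologicalClosure := by rw [this]; trivial
    exact h2
  exact closure_minimal hsub hcl htop

/-- The map `t ↦ 1/(1+|t|)` into the unit interval. -/
noncomputable def stE (t : ℝ) : Set.Icc (0:ℝ) 1 :=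
  ⟨(1 + |t|)⁻¹, by positivity, inv_le_one_of_one_le₀ (by linarith [abs_nonneg t])⟩

lemma stE_cont : Continuous stE := by
  unfold stE
  refine Continuous.subtype_mk ?_ _
  refine Continuous.inv₀ (by fun_prop) (fun t => ?_)
  positivity

lemma st_int (μ : Measure ℝ) [IsFiniteMeasure μ] (g : C(Set.Icc (0:ℝ) 1, ℂ)) :
    Integrable (fun t => g (stE t)) μ := by
  refine Integrable.of_bound (C := ‖g‖) ?_ (.of_forall fun t => g.norm_coe_le_norm _)
  exact (g.continuous.comp stE_cont).aestronglyMeasurable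

/-- The limit functional. -/
noncomputable def stL (μ : Measure ℝ) [IsFiniteMeasure μ] (c : ℝ) :
    C(Set.Icc (0:ℝ) 1, ℂ) →L[ℂ] ℂ :=
  LinearMap.mkContinuous
    { toFun := fun g => (∫ t, g (stE t) ∂μ) + (c : ℂ) * g ⟨0, by simp⟩
      map_add' := fun f g => by
        simp only [ContinuousMap.add_apply]
        rw [integral_add (st_int μ f) (st_int μ g)]
        ring
      map_smul' := fun a g => by
        simp only [ContinuousMap.smul_apply, smul_eq_mul, RingHom.id_apply]
        rw [integral_const_mul]
        ring } (μ.real Set.univ + |c|) (fun g => by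
      refine (norm_add_le _ _).trans ?_
      rw [add_mul]
      gcongr
      · rw [mul_comm]
        exact norm_integral_le_of_norm_le_const (.of_forall fun t => g.norm_coe_le_norm _)
      · rw [norm_mul]
        gcongr
        · simp
        · exact g.norm_coe_le_norm _)

lemma stL_apply (μ : Measure ℝ) [IsFiniteMeasure μ] (c : ℝ) (g : C(Set.Icc (0:ℝ) 1, ℂ)) :
    stL μ c g = (∫ t, g (stE t) ∂μ) + (c : ℂ) * g ⟨0, by simp⟩ := rfl

lemma stL_norm (μ : Measure ℝ) [IsFiniteMeasure μ] (c : ℝ) :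
    ‖stL μ c‖ ≤ μ.real Set.univ + |c| :=
  LinearMap.mkContinuous_norm_le _ (by positivity) _

lemma st_kernel {w : ℂ} (hw : w.re < 0) {t : ℝ} (ht : 0 ≤ t) :
    stK (-w) (stE t) = (1 + (t : ℂ) * w) / (w - (t : ℂ)) := by
  have hs : -w ∈ Complex.slitPlane := by rw [Complex.mem_slitPlane_iff]; left; simpa using hw
  have hne := st_ne hs (stE t)
  rw [stK_apply hs]
  have h1 : w - (t:ℂ) ≠ 0 := by
    intro h
    have := congrArg Complex.re h
    simp at this
    linarith
  have h3 : (1 + (t:ℂ)) ≠ 0 := by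
    intro h
    have := congrArg Complex.re h
    simp at this
    linarith
  have h2 : (((stE t : Set.Icc (0:ℝ) 1) : ℝ) : ℂ) = (1 + (t:ℂ))⁻¹ := by
    simp [stE, abs_of_nonneg ht]
  rw [h2] at hne ⊢
  have h4 : (1 - (1 - -w) * (1 + (t:ℂ))⁻¹) = (t - w) * (1 + (t:ℂ))⁻¹ := by
    field_simp
    ring
  have h5 : (t:ℂ) - w ≠ 0 := by
    intro h; apply h1; linear_combination -h
  rw [h4]
  field_simp
  ring

lemma st_im {w : ℂ} (hw : w.re < 0) (hi : 0 < w.im) {t : ℝ} :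
    w.im / (2 + 2 * w.re ^ 2 + w.im ^ 2) ≤ -((1 + (t : ℂ) * w) / (w - (t : ℂ))).im := by
  have e : -((1 + (t : ℂ) * w) / (w - (t : ℂ))).im = 
      w.im * (1 + t ^ 2) / ((w.re - t) ^ 2 + w.im ^ 2) := by
    rw [Complex.div_im, Complex.normSq_apply]
    simp
    have : (w.re - t) * (w.re - t) + w.im * w.im ≠ 0 := by nlinarith [mul_self_nonneg (w.re - t), mul_pos hi hi]
    have h' : (w.re - t) ^ 2 + w.im ^ 2 ≠ 0 := by positivity
    field_simp
    ring
  rw [e, div_le_div_iff₀ (by positivity) (by positivity), mul_assoc]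
  gcongr
  nlinarith [sq_nonneg (w.re + t), mul_nonneg (sq_nonneg t) (sq_nonneg w.re), mul_nonneg (sq_nonneg t) (sq_nonneg w.im)]

/-- Extension of `f` to the compactification. -/
lemma st_ext (f : ℝ → ℝ) (hf : ContinuousOn f (Set.Ici 0)) (L : ℝ) (hL : Tendsto f atTop (𝓝 L)) :
    ∃ g : C(Set.Icc (0:ℝ) 1, ℝ), g ⟨0, by simp⟩ = L ∧ ∀ t, 0 ≤ t → g (stE t) = f t := by
  classical
  let G : ℝ → ℝ := fun x => if x ≤ 0 then L else f (x⁻¹ - 1)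
  have hG : ContinuousOn G (Set.Icc 0 1) := by
    intro x hx
    rcases hx.1.eq_or_lt with h0 | h0
    · subst h0
      have h1 : Tendsto G (𝓝[>] 0) (𝓝 L) := by
        have h2 : Tendsto (fun x : ℝ => f (x⁻¹ - 1)) (𝓝[>] 0) (𝓝 L) :=
          hL.comp (tendsto_atTop_add_const_right _ _ tendsto_inv_nhdsGT_zero)
        refine h2.congr' ?_
        filter_upwards [self_mem_nhdsWithin] with x hx
        simp [G, not_le.mpr (Set.mem_Ioi.mp hx)]
      have h3 : ContinuousWithinAt G (Set.Ioi 0) 0 := by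
        simpa [ContinuousWithinAt, G] using h1
      have h4 : ContinuousWithinAt G (Set.Ici 0) 0 := by
        rw [← Set.Ioi_insert]
        exact h3.insert
      exact h4.mono Set.Icc_subset_Ici_self
    · have h1 : ContinuousWithinAt (fun x : ℝ => f (x⁻¹ - 1)) (Set.Ioc 0 1) x := by
        have h2 : ContinuousOn (fun x : ℝ => f (x⁻¹ - 1)) (Set.Ioc 0 1) := by
          refine hf.comp (ContinuousOn.sub (continuousOn_inv₀.mono ?_) continuousOn_const) ?_
          · intro y hy; exact hy.1.ne'
          · intro y hy
            have := (one_le_inv₀ hy.1).mpr hy.2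
            simpa using this
        exact h2 x ⟨h0, hx.2⟩
      have h3 : ContinuousWithinAt G (Set.Ioc 0 1) x :=
        h1.congr (fun y hy => by simp [G, not_le.mpr hy.1]) (by simp [G, not_le.mpr h0])
      refine h3.mono_of_mem_nhdsWithin ?_
      filter_upwards [self_mem_nhdsWithin, mem_nhdsWithin_of_mem_nhds (Ioi_mem_nhds h0)] with y h1 h2
      exact ⟨h2, h1.2⟩
  refine ⟨⟨fun x => G x, continuousOn_iff_continuous_domRestrict.mp hG⟩, if_pos le_rfl, ?_⟩
  intro t ht
  have : ¬ ((1 + t)⁻¹ ≤ 0) := not_le.mpr (by positivity)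
  change G ((1 + |t|)⁻¹) = f t
  rw [abs_of_nonneg ht]
  simp only [G]
  rw [if_neg this]
  simp

lemma st_closed (Λ : ℕ → (C(Set.Icc (0:ℝ) 1, ℂ) →L[ℂ] ℂ)) (Λ₀ : C(Set.Icc (0:ℝ) 1, ℂ) →L[ℂ] ℂ)
    (M : ℝ) (hM : ∀ n, ‖Λ n‖ ≤ M) :
    IsClosed {g | Tendsto (fun n => Λ n g) atTop (𝓝 (Λ₀ g))} := by
  refine Equicontinuous.isClosed_setOfPred_tendsto (F := fun n g => Λ n g) ?_ Λ₀.continuous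
  apply UniformEquicontinuous.equicontinuous
  refine LipschitzWith.uniformEquicontinuous _ (Real.toNNReal M) (fun n => ?_)
  refine (Λ n).lipschitz.weaken ?_
  exact NNReal.le_toNNReal_of_coe_le (hM n)

/-- main abstract step -/
lemma st_main (Λ : ℕ → (C(Set.Icc (0:ℝ) 1, ℂ) →L[ℂ] ℂ)) (Λ₀ : C(Set.Icc (0:ℝ) 1, ℂ) →L[ℂ] ℂ)
    (M : ℝ) (hM : ∀ n, ‖Λ n‖ ≤ M) (γn : ℕ → ℂ) (γ : ℂ)
    (V : Set ℂ) (hV : IsOpen V) (s₀ : ℂ) (hs₀U : s₀ ∈ V) (hs₀ : s₀ ∈ Complex.slitPlane)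
    (h : ∀ s ∈ V, Tendsto (fun n => γn n + Λ n (stK s)) atTop (𝓝 (γ + Λ₀ (stK s)))) 
    (g : C(Set.Icc (0:ℝ) 1, ℝ)) :
    Tendsto (fun n => Λ n ⟨fun x => (g x : ℂ), by fun_prop⟩) atTop
      (𝓝 (Λ₀ ⟨fun x => (g x : ℂ), by fun_prop⟩)) := by
  let A : Submodule ℂ C(Set.Icc (0:ℝ) 1, ℂ) :=
    { carrier := {g | Tendsto (fun n => Λ n g) atTop (𝓝 (Λ₀ g))}
      zero_mem' := by simp
      add_mem' := fun {a b} ha hb => by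
        simpa using Tendsto.add ha hb
      smul_mem' := fun a g hg => by
        simpa using Tendsto.const_mul a hg }
  have hA : IsClosed (A : Set C(Set.Icc (0:ℝ) 1, ℂ)) := st_closed Λ Λ₀ M hM
  refine st_real A hA (st_dense A hA V hV s₀ hs₀U hs₀ ?_) g
  intro s hs
  have := (h s hs).sub (h s₀ hs₀U)
  simp only [add_sub_add_left_eq_sub, ← map_sub] at this
  exact this

lemma st_main' (Λ : ℕ → (C(Set.Icc (0:ℝ) 1, ℂ) →L[ℂ] ℂ)) (Λ₀ : C(Set.Icc (0:ℝ) 1, ℂ) →L[ℂ] ℂ)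
    (h : ∀ g : C(Set.Icc (0:ℝ) 1, ℝ), Tendsto (fun n => Λ n ⟨fun x => (g x : ℂ), by fun_prop⟩) atTop
      (𝓝 (Λ₀ ⟨fun x => (g x : ℂ), by fun_prop⟩))) (g : C(Set.Icc (0:ℝ) 1, ℂ)) :
    Tendsto (fun n => Λ n g) atTop (𝓝 (Λ₀ g)) := by
  have h1 := h ⟨fun x => (g x).re, by fun_prop⟩
  have h2 := h ⟨fun x => (g x).im, by fun_prop⟩
  have h3 := h1.add (h2.const_mul Complex.I)
  have e : g = (⟨fun x => ((g x).re : ℂ), by fun_prop⟩ : C(Set.Icc (0:ℝ) 1, ℂ)) +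
      Complex.I • (⟨fun x => ((g x).im : ℂ), by fun_prop⟩ : C(Set.Icc (0:ℝ) 1, ℂ)) := by
    ext x
    simp [mul_comm Complex.I, Complex.re_add_im]
  rw [e]
  simp only [map_add, map_smul, smul_eq_mul]
  exact h3

/-- Let `(σ_n)` be finite positive Borel measures on `(0, +∞)`, `(γ_n)` real numbers,
`σ₀` a finite positive Borel measure on `[0, +∞)`, `c ≥ 0`, `γ ∈ ℝ`, and `U` a nonempty
open subset of `{Re w < 0, Im w > 0}`.  If for every `w ∈ U`,
`γ_n + ∫_{(0,∞)} (1 + tw)/(w − t) dσ_n(t) → γ + ∫_{[0,∞)} (1 + tw)/(w − t) dσ₀(t) − c w`,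
then `γ_n → γ` and `σ_n` converges weakly on `[0, +∞]` to `σ₀` plus an atom of mass `c`
at `+∞`: for every bounded continuous `f : [0, +∞) → ℝ` with finite limit `L_f` at `+∞`,
`∫_{(0,∞)} f dσ_n → ∫_{[0,∞)} f dσ₀ + c L_f`. -/
theorem stmt_17 (σn : ℕ → Measure ℝ) [∀ n, IsFiniteMeasure (σn n)]
    (hσn : ∀ n, σn n (Set.Ioi (0 : ℝ))ᶜ = 0)
    (γn : ℕ → ℝ) (σ0 : Measure ℝ) [IsFiniteMeasure σ0]
    (hσ0 : σ0 (Set.Ici (0 : ℝ))ᶜ = 0)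
    (c γ : ℝ) (hc : 0 ≤ c)
    (U : Set ℂ) (hUopen : IsOpen U) (hUne : U.Nonempty)
    (hUsub : U ⊆ {w : ℂ | w.re < 0 ∧ 0 < w.im})
    (hconv : ∀ w ∈ U,
      Tendsto (fun n => (γn n : ℂ) +
          ∫ t in Set.Ioi (0 : ℝ), (1 + (t : ℂ) * w) / (w - (t : ℂ)) ∂(σn n))
        atTop
        (𝓝 ((γ : ℂ) + (∫ t in Set.Ici (0 : ℝ), (1 + (t : ℂ) * w) / (w - (t : ℂ)) ∂σ0)
          - (c : ℂ) * w))) :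
    Tendsto γn atTop (𝓝 γ) ∧
    ∀ f : ℝ → ℝ, ContinuousOn f (Set.Ici 0) → (∃ B : ℝ, ∀ x ∈ Set.Ici (0 : ℝ), |f x| ≤ B) →
      ∀ L : ℝ, Tendsto f atTop (𝓝 L) →
        Tendsto (fun n => ∫ t in Set.Ioi (0 : ℝ), f t ∂(σn n)) atTop
          (𝓝 ((∫ t in Set.Ici (0 : ℝ), f t ∂σ0) + c * L)) := by
  have hK : ∀ w : ℂ, w.re < 0 → ∀ n, stL ((σn n).restrict (Set.Ioi 0)) 0 (stK (-w)) =
      ∫ t in Set.Ioi (0 : ℝ), (1 + (t : ℂ) * w) / (w - (t : ℂ)) ∂(σn n) := by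
    intro w hw n
    rw [stL_apply]
    simp only [Complex.ofReal_zero, zero_mul, add_zero]
    exact setIntegral_congr_fun measurableSet_Ioi fun t ht => st_kernel hw (le_of_lt ht)
  have hK0 : ∀ w : ℂ, w.re < 0 → stL (σ0.restrict (Set.Ici 0)) c (stK (-w)) =
      (∫ t in Set.Ici (0 : ℝ), (1 + (t : ℂ) * w) / (w - (t : ℂ)) ∂σ0) - (c : ℂ) * w := by
    intro w hw
    rw [stL_apply, stK_apply (by rw [Complex.mem_slitPlane_iff]; left; simpa using hw)]
    have : ∫ t in Set.Ici (0 : ℝ), stK (-w) (stE t) ∂σ0 =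
        ∫ t in Set.Ici (0 : ℝ), (1 + (t : ℂ) * w) / (w - (t : ℂ)) ∂σ0 :=
      setIntegral_congr_fun measurableSet_Ici fun t ht => st_kernel hw ht
    rw [this]
    simp
    ring
  have hconv' : ∀ w ∈ U, Tendsto (fun n => (γn n : ℂ) +
      stL ((σn n).restrict (Set.Ioi 0)) 0 (stK (-w))) atTop
      (𝓝 ((γ : ℂ) + stL (σ0.restrict (Set.Ici 0)) c (stK (-w)))) := by
    intro w hw
    have hw' := (hUsub hw).1
    simp only [hK w hw', hK0 w hw', ← add_sub_assoc]
    exact hconv w hw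
  obtain ⟨w₀, hw₀⟩ := hUne
  obtain ⟨hre, him⟩ := hUsub hw₀
  -- boundedness of masses
  obtain ⟨M, hM⟩ : ∃ M, ∀ n, ((σn n).restrict (Set.Ioi 0)).real Set.univ ≤ M := by
    have h1 : Tendsto (fun n => ((γn n : ℂ) +
        ∫ t in Set.Ioi (0 : ℝ), (1 + (t : ℂ) * w₀) / (w₀ - (t : ℂ)) ∂(σn n)).im) atTop _ :=
      (Complex.continuous_im.tendsto _).comp (hconv w₀ hw₀)
    obtain ⟨B, hB⟩ := h1.bddBelow_range
    have hδ : 0 < w₀.im / (2 + 2 * w₀.re ^ 2 + w₀.im ^ 2) := by positivity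
    refine ⟨-B / (w₀.im / (2 + 2 * w₀.re ^ 2 + w₀.im ^ 2)), fun n => ?_⟩
    rw [le_div_iff₀ hδ]
    have hb := hB ⟨n, rfl⟩
    have hint : Integrable (fun t : ℝ => (1 + (t : ℂ) * w₀) / (w₀ - (t : ℂ)))
        ((σn n).restrict (Set.Ioi 0)) := by
      refine (st_int ((σn n).restrict (Set.Ioi 0)) (stK (-w₀))).congr ?_
      filter_upwards [ae_restrict_mem measurableSet_Ioi] with t ht
      exact st_kernel hre (le_of_lt ht)
    have him2 : (∫ t in Set.Ioi (0 : ℝ), (1 + (t : ℂ) * w₀) / (w₀ - (t : ℂ)) ∂(σn n)).im =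
        ∫ t in Set.Ioi (0 : ℝ), ((1 + (t : ℂ) * w₀) / (w₀ - (t : ℂ))).im ∂(σn n) :=
      (integral_im hint).symm
    have h2 : ∫ t in Set.Ioi (0 : ℝ), (w₀.im / (2 + 2 * w₀.re ^ 2 + w₀.im ^ 2)) ∂(σn n) ≤
        ∫ t in Set.Ioi (0 : ℝ), -((1 + (t : ℂ) * w₀) / (w₀ - (t : ℂ))).im ∂(σn n) :=
      integral_mono (integrable_const _) hint.im.neg (fun t => st_im hre him)
    rw [integral_neg, ← him2, integral_const, smul_eq_mul] at h2
    simp only [Complex.add_im, Complex.ofReal_im, zero_add] at hb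
    linarith
  have hnorm : ∀ n, ‖stL ((σn n).restrict (Set.Ioi 0)) 0‖ ≤ M := fun n =>
    (stL_norm _ _).trans (by simpa using hM n)
  have hmain := st_main (fun n => stL ((σn n).restrict (Set.Ioi 0)) 0)
    (stL (σ0.restrict (Set.Ici 0)) c) M hnorm (fun n => (γn n : ℂ)) γ (-U) hUopen.neg (-w₀)
    (by simpa using hw₀) (by rw [Complex.mem_slitPlane_iff]; left; simpa using hre)
    (fun s hs => by simpa using hconv' (-s) hs)
  refine ⟨?_, ?_⟩
  · have h1 := (hconv' w₀ hw₀).sub (st_main' _ _ hmain (stK (-w₀)))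
    simp only [add_sub_cancel_right] at h1
    exact (Complex.continuous_re.tendsto _).comp h1
  · intro f hf _ L hL
    obtain ⟨g, hg0, hg⟩ := st_ext f hf L hL
    have h1 := (Complex.continuous_re.tendsto _).comp (hmain g)
    have e1 : ∀ n, (stL ((σn n).restrict (Set.Ioi 0)) 0 ⟨fun x => (g x : ℂ), by fun_prop⟩).re =
        ∫ t in Set.Ioi (0 : ℝ), f t ∂(σn n) := by
      intro n
      rw [stL_apply]
      simp only [ContinuousMap.coe_mk, Complex.ofReal_zero, zero_mul, add_zero]
      rw [integral_complex_ofReal, Complex.ofReal_re]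
      exact setIntegral_congr_fun measurableSet_Ioi fun t ht => hg t (le_of_lt ht)
    have e2 : (stL (σ0.restrict (Set.Ici 0)) c ⟨fun x => (g x : ℂ), by fun_prop⟩).re =
        (∫ t in Set.Ici (0 : ℝ), f t ∂σ0) + c * L := by
      rw [stL_apply]
      simp only [ContinuousMap.coe_mk, hg0]
      rw [integral_complex_ofReal, ← Complex.ofReal_mul, ← Complex.ofReal_add, Complex.ofReal_re]
      congr 1
      exact setIntegral_congr_fun measurableSet_Ici fun t ht => hg t ht
    rw [e2] at h1
    exact h1.congr e1
end
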